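/- Let A_n be the free associative unital ℂ-algebra on generators x_1,…,x_n, and let D : A_n → A_n be a derivation (a ℂ-linear map with D(ab) = D(a)b + aD(b)) such that D(A_n) ⊆ M_3(A_n). Then D(M_i(A_n)) ⊆ M_{i+1}(A_n) for every i ≥ 1. -/

import Mathlib

noncomputable section

/-- `lcs k A n` is the `(n+1)`-st term `L_{n+1}(A)` of the lower central series of `A`
regarded as a Lie algebra under the commutator `[a,b] = a*b - b*a`:
`lcs k A 0 = L_1(A) = A` and `L_{n+2}(A) = span [A, L_{n+1}(A)]`. -/
def lcs (k A : Type*) [Field k] [Ring A] [Algebra k A] : ℕ → Submodule k A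
  | 0 => ⊤
  | n + 1 => Submodule.span k {x | ∃ a : A, ∃ b ∈ lcs k A n, x = a * b - b * a}

/-- `Lser k A i = L_i(A)` for `i ≥ 1`. -/
def Lser (k A : Type*) [Field k] [Ring A] [Algebra k A] (i : ℕ) : Submodule k A :=
  lcs k A (i - 1)

/-- The two-sided ideal of `A` generated by a set `S`, as a `k`-submodule. -/
def idealGen (k : Type*) {A : Type*} [Field k] [Ring A] [Algebra k A] (S : Set A) :
    Submodule k A :=
  Submodule.span k {x | ∃ a b : A, ∃ s ∈ S, x = a * s * b}

/-- `Mser k A i = M_i(A)`, the two-sided ideal of `A` generated by `L_i(A)`. -/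
def Mser (k A : Type*) [Field k] [Ring A] [Algebra k A] (i : ℕ) : Submodule k A :=
  idealGen k (Lser k A i : Set A)

/-- The element `[a[b,c], d]`. -/
def mulCommBracket {A : Type*} [Ring A] (a b c d : A) : A :=
  a * (b * c - c * b) * d - d * (a * (b * c - c * b))

lemma map_mulCommBracket_swap_left_right {A Q : Type*} [Ring A] [AddCommGroup Q] (f : A →+ Q)
    (hf : ∀ x y z : A, f ((x * y - y * x) * z - z * (x * y - y * x)) = 0) (a b c d : A) :
    f (mulCommBracket a b c d) = -f (mulCommBracket d b c a) := by
  have e : mulCommBracket a b c d + mulCommBracket d b c a =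
      ((d * (b * c - c * b) - (b * c - c * b) * d) * a
        - a * (d * (b * c - c * b) - (b * c - c * b) * d))
      + ((b * c - c * b) * (d * a) - (d * a) * (b * c - c * b)) := by
    unfold mulCommBracket; noncomm_ring
  rw [eq_neg_iff_add_eq_zero, ← map_add, e, map_add, hf, hf, add_zero]

lemma map_mulCommBracket_swap_left {A Q : Type*} [Ring A] [AddCommGroup Q] (f : A →+ Q)
    (hf : ∀ x y z : A, f ((x * y - y * x) * z - z * (x * y - y * x)) = 0) (a b c d : A) :
    f (mulCommBracket a b c d) = -f (mulCommBracket b a c d) := by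
  have e : mulCommBracket a b c d + mulCommBracket b a c d =
      ((a * b * c - c * (a * b)) * d - d * (a * b * c - c * (a * b)))
      - (((a * c - c * a) * b - b * (a * c - c * a)) * d
        - d * ((a * c - c * a) * b - b * (a * c - c * a))) := by
    unfold mulCommBracket; noncomm_ring
  rw [eq_neg_iff_add_eq_zero, ← map_add, e, map_sub, hf, hf, sub_zero]

lemma map_mulCommBracket_swap_middle {A Q : Type*} [Ring A] [AddCommGroup Q] (f : A →+ Q)
    (a b c d : A) : f (mulCommBracket a b c d) = -f (mulCommBracket a c b d) := by
  rw [← map_neg]; congr 1; unfold mulCommBracket; noncomm_ring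

lemma map_mulCommBracket_swap_right {A Q : Type*} [Ring A] [AddCommGroup Q] (f : A →+ Q)
    (hf : ∀ x y z : A, f ((x * y - y * x) * z - z * (x * y - y * x)) = 0) (a b c d : A) :
    f (mulCommBracket a b c d) = -f (mulCommBracket a b d c) := by
  rw [map_mulCommBracket_swap_middle, map_mulCommBracket_swap_left f hf,
    map_mulCommBracket_swap_left_right f hf, map_mulCommBracket_swap_left f hf,
    map_mulCommBracket_swap_middle f a d b c]
  simp

lemma map_mulCommBracket_swap_pairs {A Q : Type*} [Ring A] [AddCommGroup Q] (f : A →+ Q)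
    (hf : ∀ x y z : A, f ((x * y - y * x) * z - z * (x * y - y * x)) = 0) (a b c d e : A) :
    f (mulCommBracket (a * b - b * a) c d e) = f (mulCommBracket (c * d - d * c) a b e) := by
  rw [← sub_eq_zero, ← map_sub, ← hf (a * b - b * a) (c * d - d * c) e]
  congr 1; unfold mulCommBracket; noncomm_ring

lemma map_mulCommBracket_swap_inner {A Q : Type*} [Ring A] [AddCommGroup Q] (f : A →+ Q)
    (hf : ∀ x y z : A, f ((x * y - y * x) * z - z * (x * y - y * x)) = 0) (a b c d e : A) :
    f (mulCommBracket (a * b - b * a) c d e) = -f (mulCommBracket (a * d - d * a) c b e) := by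
  rw [map_mulCommBracket_swap_right f hf, map_mulCommBracket_swap_pairs f hf,
    map_mulCommBracket_swap_right f hf, map_mulCommBracket_swap_pairs f hf,
    map_mulCommBracket_swap_right f hf]
  simp

lemma map_mulCommBracket_neg_comm {A Q : Type*} [Ring A] [AddCommGroup Q] (f : A →+ Q)
    (a b c d e : A) :
    f (mulCommBracket (a * b - b * a) c d e) = -f (mulCommBracket (b * a - a * b) c d e) := by
  rw [← map_neg]; congr 1; unfold mulCommBracket; noncomm_ring

/-- An additive map killing all `[[x,y],z]` kills `3[a[b,[c,d]],e]`. -/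
lemma three_nsmul_map_mulCommBracket {A Q : Type*} [Ring A] [AddCommGroup Q] (f : A →+ Q)
    (hf : ∀ x y z : A, f ((x * y - y * x) * z - z * (x * y - y * x)) = 0) (a b c d e : A) :
    3 • f (mulCommBracket a b (c * d - d * c) e) = 0 := by
  have key (p r s : A) : f (mulCommBracket a p (r * s - s * r) e) =
      f (mulCommBracket (r * s - s * r) a p e) := by
    rw [map_mulCommBracket_swap_middle, map_mulCommBracket_swap_left f hf, neg_neg]
  have jacobi : f (mulCommBracket a b (c * d - d * c) e)
      + f (mulCommBracket a d (b * c - c * b) e)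
      + f (mulCommBracket a c (d * b - b * d) e) = 0 := by
    rw [← map_add, ← map_add, ← map_zero f]
    congr 1; unfold mulCommBracket; noncomm_ring
  have h₁ : f (mulCommBracket (b * c - c * b) a d e) =
      f (mulCommBracket (c * d - d * c) a b e) := by
    rw [map_mulCommBracket_neg_comm, map_mulCommBracket_swap_inner f hf, neg_neg]
  have h₂ : f (mulCommBracket (d * b - b * d) a c e) =
      f (mulCommBracket (c * d - d * c) a b e) := by
    rw [map_mulCommBracket_swap_inner f hf, map_mulCommBracket_neg_comm, neg_neg]
  rw [key, key, key, h₁, h₂] at jacobi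
  rw [key, ← jacobi]
  abel

section Field

variable {k A : Type*} [Field k] [Ring A] [Algebra k A]

lemma commutator_mem_lcs_succ (a : A) {b : A} {n : ℕ} (hb : b ∈ lcs k A n) :
    a * b - b * a ∈ lcs k A (n + 1) :=
  Submodule.subset_span ⟨a, b, hb, rfl⟩

lemma commutator_mem_lcs_succ' {a : A} (b : A) {n : ℕ} (ha : a ∈ lcs k A n) :
    a * b - b * a ∈ lcs k A (n + 1) := by
  rw [← neg_sub]
  exact neg_mem (commutator_mem_lcs_succ b ha)

lemma lcs_succ_le (n : ℕ) : lcs k A (n + 1) ≤ lcs k A n := by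
  induction n with
  | zero => exact le_top
  | succ n ih =>
    refine Submodule.span_le.2 ?_
    rintro _ ⟨a, b, hb, rfl⟩
    exact commutator_mem_lcs_succ a (ih hb)

lemma idealGen_mono {S T : Set A} (h : S ⊆ T) : idealGen k S ≤ idealGen k T := by
  refine Submodule.span_mono ?_
  rintro _ ⟨a, b, s, hs, rfl⟩
  exact ⟨a, b, s, h hs, rfl⟩

lemma subset_idealGen (S : Set A) : S ⊆ idealGen k S :=
  fun s hs => Submodule.subset_span ⟨1, 1, s, hs, by simp⟩

lemma mul_mem_idealGen_left {S : Set A} (c : A) {x : A} (hx : x ∈ idealGen k S) :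
    c * x ∈ idealGen k S := by
  induction hx using Submodule.span_induction with
  | mem x h =>
    obtain ⟨a, b, s, hs, rfl⟩ := h
    exact Submodule.subset_span ⟨c * a, b, s, hs, by simp only [mul_assoc]⟩
  | zero => simp
  | add x y _ _ hx hy => rw [mul_add]; exact add_mem hx hy
  | smul r x _ hx => rw [mul_smul_comm]; exact Submodule.smul_mem _ r hx

lemma mul_mem_idealGen_right {S : Set A} (c : A) {x : A} (hx : x ∈ idealGen k S) :
    x * c ∈ idealGen k S := by
  induction hx using Submodule.span_induction with
  | mem x h =>
    obtain ⟨a, b, s, hs, rfl⟩ := h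
    exact Submodule.subset_span ⟨a, b * c, s, hs, by simp only [mul_assoc]⟩
  | zero => simp
  | add x y _ _ hx hy => rw [add_mul]; exact add_mem hx hy
  | smul r x _ hx => rw [smul_mul_assoc]; exact Submodule.smul_mem _ r hx

lemma commutator_mem_lcs_add {m n : ℕ} {x y : A} (hx : x ∈ lcs k A m) (hy : y ∈ lcs k A n) :
    x * y - y * x ∈ lcs k A (m + n + 1) := by
  induction n generalizing x y m with
  | zero => exact commutator_mem_lcs_succ' y hx
  | succ n ih =>
    induction hy using Submodule.span_induction with
    | mem y h =>
      obtain ⟨a, b, hb, rfl⟩ := h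
      have e : x * (a * b - b * a) - (a * b - b * a) * x =
          ((x * a - a * x) * b - b * (x * a - a * x)) +
            (a * (x * b - b * x) - (x * b - b * x) * a) := by noncomm_ring
      have h₁ := ih (commutator_mem_lcs_succ' a hx) hb
      rw [show m + 1 + n + 1 = m + (n + 1) + 1 by omega] at h₁
      rw [e]
      exact add_mem h₁ (commutator_mem_lcs_succ a (ih hx hb))
    | zero => simp
    | add y z _ _ hy hz =>
      rw [show x * (y + z) - (y + z) * x = (x * y - y * x) + (x * z - z * x) by noncomm_ring]
      exact add_mem hy hz
    | smul r y _ hy =>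
      rw [mul_smul_comm, smul_mul_assoc, ← smul_sub]
      exact Submodule.smul_mem _ r hy

lemma commutator_mul_mem_lcs_two [CharZero k] (a d : A) {s : A} (hs : s ∈ lcs k A 2) :
    a * s * d - d * (a * s) ∈ lcs k A 2 := by
  have hf (x y z : A) : (lcs k A 2).mkQ.toAddMonoidHom
      ((x * y - y * x) * z - z * (x * y - y * x)) = 0 :=
    (Submodule.Quotient.mk_eq_zero _).2 <|
      commutator_mem_lcs_succ' z (commutator_mem_lcs_succ (n := 0) x Submodule.mem_top)
  induction hs using Submodule.span_induction with
  | mem s h =>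
    obtain ⟨b, c, hc, rfl⟩ := h
    induction hc using Submodule.span_induction with
    | mem c h =>
      obtain ⟨p, q, -, rfl⟩ := h
      have h₃ := three_nsmul_map_mulCommBracket _ hf a b p q d
      rw [← Nat.cast_smul_eq_nsmul k, smul_eq_zero] at h₃
      exact (Submodule.Quotient.mk_eq_zero _).1 (h₃.resolve_left (by norm_num))
    | zero => simp
    | add x y _ _ hx hy => convert add_mem hx hy using 1; noncomm_ring
    | smul r x _ hx =>
      convert Submodule.smul_mem _ r hx using 1
      simp only [mul_smul_comm, smul_mul_assoc, ← smul_sub]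
  | zero => simp
  | add x y _ _ hx hy => convert add_mem hx hy using 1; noncomm_ring
  | smul r x _ hx =>
    convert Submodule.smul_mem _ r hx using 1
    simp only [mul_smul_comm, smul_mul_assoc, ← smul_sub]

/-- `[M_3, L_1] ⊆ L_3`. -/
lemma commutator_idealGen_mem_lcs_two [CharZero k] {u : A}
    (hu : u ∈ idealGen k (lcs k A 2 : Set A)) (d : A) : u * d - d * u ∈ lcs k A 2 := by
  induction hu using Submodule.span_induction with
  | mem u h =>
    obtain ⟨a, b, s, hs, rfl⟩ := h
    have e : a * s * b * d - d * (a * s * b) =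
        (b * a * s * d - d * (b * a * s)) - ((b * (a * s) - a * s * b) * d
          - d * (b * (a * s) - a * s * b)) := by noncomm_ring
    rw [e]
    exact sub_mem (commutator_mul_mem_lcs_two _ _ hs) <|
      commutator_mem_lcs_succ' d (commutator_mem_lcs_succ (n := 0) b Submodule.mem_top)
  | zero => simp
  | add x y _ _ hx hy => convert add_mem hx hy using 1; noncomm_ring
  | smul r x _ hx =>
    convert Submodule.smul_mem _ r hx using 1
    simp only [mul_smul_comm, smul_mul_assoc, ← smul_sub]

/-- `[M_3, L_{n+1}] ⊆ L_{n+3}`. -/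
lemma commutator_idealGen_mem_lcs [CharZero k] {n : ℕ} {u y : A}
    (hu : u ∈ idealGen k (lcs k A 2 : Set A)) (hy : y ∈ lcs k A n) :
    u * y - y * u ∈ lcs k A (n + 2) := by
  induction n generalizing y with
  | zero => exact commutator_idealGen_mem_lcs_two hu y
  | succ n ih =>
    induction hy using Submodule.span_induction with
    | mem y h =>
      obtain ⟨a, b, hb, rfl⟩ := h
      have e : u * (a * b - b * a) - (a * b - b * a) * u =
          ((u * a - a * u) * b - b * (u * a - a * u)) +
            (a * (u * b - b * u) - (u * b - b * u) * a) := by noncomm_ring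
      have h₁ := commutator_mem_lcs_add (commutator_idealGen_mem_lcs_two hu a) hb
      rw [show 2 + n + 1 = n + 1 + 2 by omega] at h₁
      rw [e]
      exact add_mem h₁ (commutator_mem_lcs_succ a (ih hb))
    | zero => simp
    | add y z _ _ hy hz => convert add_mem hy hz using 1; noncomm_ring
    | smul r y _ hy =>
      convert Submodule.smul_mem _ r hy using 1
      simp only [mul_smul_comm, smul_mul_assoc, ← smul_sub]

/-- `M_3 L_{n+2} ⊆ M_{n+3}`. -/
lemma mul_mem_idealGen_lcs_of_left [CharZero k] {n : ℕ} {u s : A}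
    (hu : u ∈ idealGen k (lcs k A 2 : Set A)) (hs : s ∈ lcs k A (n + 1)) :
    u * s ∈ idealGen k (lcs k A (n + 2) : Set A) := by
  induction hs using Submodule.span_induction with
  | mem s h =>
    obtain ⟨d, m, hm, rfl⟩ := h
    have e : u * (d * m - m * d) = (u * d * m - m * (u * d)) - (u * m - m * u) * d := by
      noncomm_ring
    rw [e]
    exact sub_mem
      (subset_idealGen _ (commutator_idealGen_mem_lcs (mul_mem_idealGen_right d hu) hm))
      (mul_mem_idealGen_right d (subset_idealGen _ (commutator_idealGen_mem_lcs hu hm)))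
  | zero => simp
  | add x y _ _ hx hy => rw [mul_add]; exact add_mem hx hy
  | smul r x _ hx => rw [mul_smul_comm]; exact Submodule.smul_mem _ r hx

/-- `L_{n+2} M_3 ⊆ M_{n+3}`. -/
lemma mul_mem_idealGen_lcs_of_right [CharZero k] {n : ℕ} {u s : A}
    (hu : u ∈ idealGen k (lcs k A 2 : Set A)) (hs : s ∈ lcs k A (n + 1)) :
    s * u ∈ idealGen k (lcs k A (n + 2) : Set A) := by
  rw [← sub_sub_self (u * s) (s * u)]
  exact sub_mem (mul_mem_idealGen_lcs_of_left hu hs)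
    (subset_idealGen _ (lcs_succ_le _ (commutator_idealGen_mem_lcs hu hs)))

lemma derivation_mem_lcs_succ [CharZero k] (D : A →ₗ[k] A)
    (hLeib : ∀ a b : A, D (a * b) = D a * b + a * D b)
    (hRange : ∀ a : A, D a ∈ idealGen k (lcs k A 2 : Set A)) {n : ℕ} {x : A}
    (hx : x ∈ lcs k A (n + 1)) : D x ∈ lcs k A (n + 2) := by
  induction n generalizing x with
  | zero =>
    induction hx using Submodule.span_induction with
    | mem x h =>
      obtain ⟨a, b, -, rfl⟩ := h
      have e : D (a * b - b * a) = (D a * b - b * D a) - (D b * a - a * D b) := by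
        rw [map_sub, hLeib, hLeib]; abel
      rw [e]
      exact sub_mem (commutator_idealGen_mem_lcs_two (hRange a) b)
        (commutator_idealGen_mem_lcs_two (hRange b) a)
    | zero => simp
    | add x y _ _ hx hy => rw [map_add]; exact add_mem hx hy
    | smul r x _ hx => rw [map_smul]; exact Submodule.smul_mem _ r hx
  | succ n ih =>
    induction hx using Submodule.span_induction with
    | mem x h =>
      obtain ⟨a, b, hb, rfl⟩ := h
      have e : D (a * b - b * a) = (D a * b - b * D a) + (a * D b - D b * a) := by
        rw [map_sub, hLeib, hLeib]; abel
      rw [e]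
      exact add_mem (commutator_idealGen_mem_lcs (hRange a) hb)
        (commutator_mem_lcs_succ a (ih hb))
    | zero => simp
    | add x y _ _ hx hy => rw [map_add]; exact add_mem hx hy
    | smul r x _ hx => rw [map_smul]; exact Submodule.smul_mem _ r hx

lemma derivation_mem_idealGen_lcs_succ [CharZero k] (D : A →ₗ[k] A)
    (hLeib : ∀ a b : A, D (a * b) = D a * b + a * D b)
    (hRange : ∀ a : A, D a ∈ idealGen k (lcs k A 2 : Set A)) {n : ℕ} {x : A}
    (hx : x ∈ idealGen k (lcs k A n : Set A)) : D x ∈ idealGen k (lcs k A (n + 1) : Set A) := by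
  cases n with
  | zero => exact idealGen_mono (lcs_succ_le 1) (hRange x)
  | succ n =>
    induction hx using Submodule.span_induction with
    | mem x h =>
      obtain ⟨a, b, s, hs, rfl⟩ := h
      rw [hLeib, hLeib, add_mul, mul_assoc a s]
      exact add_mem
        (add_mem (mul_mem_idealGen_right b (mul_mem_idealGen_lcs_of_left (hRange a) hs))
          (mul_mem_idealGen_right b (mul_mem_idealGen_left a
            (subset_idealGen _ (derivation_mem_lcs_succ D hLeib hRange hs)))))
        (mul_mem_idealGen_left a (mul_mem_idealGen_lcs_of_right (hRange b) hs))
    | zero => simp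
    | add x y _ _ hx hy => rw [map_add]; exact add_mem hx hy
    | smul r x _ hx => rw [map_smul]; exact Submodule.smul_mem _ r hx

end Field

/-- If `D` is a derivation of the free associative unital `ℂ`-algebra on `n` generators
with `D(A_n) ⊆ M_3(A_n)`, then `D(M_i(A_n)) ⊆ M_{i+1}(A_n)` for every `i ≥ 1`. -/
theorem derivation_maps_Mser_to_next (n : ℕ)
    (D : FreeAlgebra ℂ (Fin n) →ₗ[ℂ] FreeAlgebra ℂ (Fin n))
    (hLeib : ∀ a b : FreeAlgebra ℂ (Fin n), D (a * b) = D a * b + a * D b)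
    (hRange : ∀ a : FreeAlgebra ℂ (Fin n), D a ∈ Mser ℂ (FreeAlgebra ℂ (Fin n)) 3)
    (i : ℕ) (hi : 1 ≤ i) :
    ∀ x ∈ Mser ℂ (FreeAlgebra ℂ (Fin n)) i, D x ∈ Mser ℂ (FreeAlgebra ℂ (Fin n)) (i + 1) := by
  obtain ⟨j, rfl⟩ := Nat.exists_eq_add_of_le' hi
  exact fun x hx => derivation_mem_idealGen_lcs_succ D hLeib hRange hx
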